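/- arXiv:0801.0857 — 2 statements merged into one kernel-verified Lean document; each statement's English description precedes it below -/
import Mathlib

section
/- For every a ∈ F_{2^n}^*, the number of roots in F of f_a(x) = x^{2^{2t}} + a^{2^l}·x^{2^t} + x is 1 or 2^{2k}, and the counts R_m = #{a ∈ F_{2^n}^* : N(f_a, F) = 1} and R_{m−2k} = #{a ∈ F_{2^n}^* : N(f_a, F) = 2^{2k}} satisfy (2^{2k} − 1)·R_m = 2^{n+2k} − 2^{n+k} − 2^n + 1 and (2^{2k} − 1)·R_{m−2k} = 2^{n+k} − 2^{2k}. -/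
open Finset

section PartialTrace

variable {F : Type*} [Field F]

/-- The sum `y + σ y + ⋯ + σ^(r-1) y`; a trace when `σ ^ r` fixes `y`. -/
def partialTrace (σ : F →+* F) (r : ℕ) (y : F) : F := ∑ i ∈ range r, (σ ^ i) y

/-- The zero set of `σ² + b σ + 1`. -/
def twistedZeros (σ : F →+* F) (b : F) : Set F := {y | σ (σ y) + b * σ y + y = 0}

theorem RingHom.pow_succ_apply (σ : F →+* F) (i : ℕ) (y : F) :
    (σ ^ (i + 1)) y = σ ((σ ^ i) y) := by
  rw [pow_succ']; rfl

theorem RingHom.pow_apply_comm (σ : F →+* F) (i : ℕ) (y : F) : (σ ^ i) (σ y) = σ ((σ ^ i) y) := by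
  rw [← RingHom.pow_succ_apply, pow_succ]; rfl

theorem RingHom.pow_apply_of_fixed {σ : F →+* F} {c : F} (hc : σ c = c) (i : ℕ) :
    (σ ^ i) c = c := by
  induction i with
  | zero => rfl
  | succ i ih => rw [RingHom.pow_succ_apply, ih, hc]

theorem partialTrace_add (σ : F →+* F) (r : ℕ) (x y : F) :
    partialTrace σ r (x + y) = partialTrace σ r x + partialTrace σ r y := by
  simp [partialTrace, sum_add_distrib]

theorem partialTrace_mul_of_fixed {σ : F →+* F} {c : F} (hc : σ c = c) (r : ℕ) (y : F) :
    partialTrace σ r (c * y) = c * partialTrace σ r y := by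
  simp only [partialTrace, mul_sum, map_mul, RingHom.pow_apply_of_fixed hc]

theorem partialTrace_comm (σ : F →+* F) (r : ℕ) (y : F) :
    partialTrace σ r (σ y) = σ (partialTrace σ r y) := by
  simp [partialTrace, RingHom.pow_apply_comm]

theorem pow_partialTrace (σ : F →+* F) (r : ℕ) (y : F) (j : ℕ) :
    (σ ^ j) (partialTrace σ r y) = partialTrace σ r ((σ ^ j) y) := by
  induction j with
  | zero => rfl
  | succ j ih => rw [RingHom.pow_succ_apply, ih, RingHom.pow_succ_apply, partialTrace_comm]

theorem map_partialTrace_add (σ : F →+* F) (r : ℕ) (y : F) :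
    σ (partialTrace σ r y) + y = partialTrace σ r y + (σ ^ r) y := by
  have h1 := sum_range_succ (fun i => (σ ^ i) y) r
  have h2 := sum_range_succ' (fun i => (σ ^ i) y) r
  simp only [partialTrace, map_sum, ← RingHom.pow_succ_apply]
  rw [← h1, h2]
  rfl

theorem map_partialTrace_of_fixed {σ : F →+* F} {r : ℕ} {y : F} (hy : (σ ^ r) y = y) :
    σ (partialTrace σ r y) = partialTrace σ r y := by
  have h := map_partialTrace_add σ r y
  rw [hy] at h
  exact add_right_cancel h

theorem zero_mem_twistedZeros (σ : F →+* F) (b : F) : (0 : F) ∈ twistedZeros σ b := by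
  simp [twistedZeros]

variable [CharP F 2]

theorem map_partialTrace_add_self (σ : F →+* F) (r : ℕ) (y : F) :
    σ (partialTrace σ r y) + partialTrace σ r y = (σ ^ r) y + y := by
  linear_combination map_partialTrace_add σ r y +
    (partialTrace σ r y - y) * CharTwo.two_eq_zero (R := F)

theorem partialTrace_fixed {σ : F →+* F} {r : ℕ} (hr : Odd r) {c : F} (hc : σ c = c) :
    partialTrace σ r c = c := by
  obtain ⟨j, rfl⟩ := hr
  simp only [partialTrace, RingHom.pow_apply_of_fixed hc, sum_const, card_range, nsmul_eq_mul]
  push_cast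
  linear_combination (j * c) * CharTwo.two_eq_zero (R := F)

theorem exists_pow_add_self_eq_one {σ : F →+* F} {r : ℕ}
    (hinv : ∀ y, (σ ^ r) ((σ ^ r) y) = y) (hne : ∃ y, (σ ^ r) y ≠ y) :
    ∃ u, (σ ^ r) u + u = 1 := by
  obtain ⟨y, hy⟩ := hne
  have h0 : (σ ^ r) y + y ≠ 0 := fun h => hy (CharTwo.add_eq_zero.1 h)
  refine ⟨y / ((σ ^ r) y + y), ?_⟩
  rw [map_div₀, map_add, hinv, add_comm y, ← add_div, div_self h0]

theorem exists_map_add_self_eq {σ : F →+* F} {r : ℕ}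
    (hinv : ∀ y, (σ ^ r) ((σ ^ r) y) = y) (hne : ∃ y, (σ ^ r) y ≠ y)
    {w : F} (hw : (σ ^ r) w = w) :
    ∃ z, σ z + z = w ∧ (σ ^ r) z + z = partialTrace σ r w := by
  obtain ⟨u, hu⟩ := exists_pow_add_self_eq_one hinv hne
  have h : (σ ^ r) (u * w) + u * w = w := by
    rw [map_mul, hw, ← add_mul, hu, one_mul]
  refine ⟨partialTrace σ r (u * w), ?_, ?_⟩
  · rw [map_partialTrace_add_self, h]
  · rw [pow_partialTrace, ← partialTrace_add, h]

theorem twistedZeros_eq_image {σ : F →+* F} {b x z : F} (hx : x ≠ 0)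
    (hxb : x ∈ twistedZeros σ b) (hz : σ z + z = (x * σ x)⁻¹) :
    twistedZeros σ b =
      (fun p : F × F => x * (p.1 * z + p.2)) '' ({c | σ c = c} ×ˢ {c | σ c = c}) := by
  have hσx : σ x ≠ 0 := (map_ne_zero σ).2 hx
  have two : (2 : F) = 0 := CharTwo.two_eq_zero
  have hz' : (x * σ x) * (σ z + z) = 1 := by
    rw [hz]; exact mul_inv_cancel₀ (mul_ne_zero hx hσx)
  have hz'' : (σ x * σ (σ x)) * (σ (σ z) + σ z) = 1 := by
    simpa using congrArg σ hz'
  have hb : σ (σ x) + b * σ x + x = 0 := hxb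
  ext y
  simp only [Set.mem_image, Set.mem_prod, Set.mem_ofPred_eq, Prod.exists]
  constructor
  · intro hy
    have hy : σ (σ y) + b * σ y + y = 0 := hy
    obtain ⟨v, rfl⟩ : ∃ v, y = x * v := ⟨y / x, by field_simp⟩
    simp only [map_mul] at hy
    set c := x * σ x * (σ v + v) with hc
    have hcc : σ c = c := by
      simp only [hc, map_mul, map_add]
      linear_combination σ x * hy - σ x * σ v * hb + (σ x * σ (σ x) * σ v - x * σ x * v) * two
    refine ⟨c, v + c * z, ⟨hcc, ?_⟩, ?_⟩
    · rw [map_add, map_mul, hcc]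
      have : σ v + v = c * (σ z + z) := by
        rw [hz, hc]; field_simp
      linear_combination this + (c * σ z - v) * two
    · linear_combination (x * c * z) * two
  · rintro ⟨c, d, ⟨hc, hd⟩, rfl⟩
    change σ (σ _) + b * σ _ + _ = 0
    simp only [map_mul, map_add, hc, hd]
    apply mul_left_cancel₀ hσx
    linear_combination (c * σ z + d) * σ x * hb + c * hz'' - c * hz' + (σ x * c * x * z - σ x * σ (σ x) * c * σ z) * two

theorem injective_mul_add {σ : F →+* F} {x z : F} (hx : x ≠ 0) (hz : σ z + z ≠ 0) :
    Set.InjOn (fun p : F × F => x * (p.1 * z + p.2)) ({c | σ c = c} ×ˢ {c | σ c = c}) := by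
  rintro ⟨c, d⟩ ⟨hc, hd⟩ ⟨c', d'⟩ ⟨hc', hd'⟩ h
  simp only [Set.mem_ofPred_eq] at hc hd hc' hd'
  have h1 : c * z + d = c' * z + d' := mul_left_cancel₀ hx h
  have h2 : c * σ z + d = c' * σ z + d' := by
    have := congrArg σ h1
    simpa [hc, hd, hc', hd'] using this
  have h3 : c = c' := by
    apply mul_right_cancel₀ hz
    linear_combination h1 + h2 + (d' - d) * CharTwo.two_eq_zero (R := F)
  subst h3
  exact Prod.ext rfl (add_left_cancel h1)

theorem ncard_twistedZeros [DecidableEq F] {σ : F →+* F} {r : ℕ}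
    (hinv : ∀ y, (σ ^ r) ((σ ^ r) y) = y) (hne : ∃ y, (σ ^ r) y ≠ y)
    {b x : F} (hx : x ≠ 0) (hxK : (σ ^ r) x = x) (hxb : x ∈ twistedZeros σ b) :
    (twistedZeros σ b).ncard = {c | σ c = c}.ncard ^ 2 ∧
    {y | y ∈ twistedZeros σ b ∧ (σ ^ r) y = y}.ncard =
      if partialTrace σ r (x * σ x)⁻¹ = 0 then {c | σ c = c}.ncard ^ 2
      else {c | σ c = c}.ncard := by
  have hσx : σ x ≠ 0 := (map_ne_zero σ).2 hx
  obtain ⟨z, hz, hτz⟩ := exists_map_add_self_eq (σ := σ) (r := r) hinv hne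
    (w := (x * σ x)⁻¹) (by rw [map_inv₀, map_mul, RingHom.pow_apply_comm, hxK])
  have himg := twistedZeros_eq_image hx hxb hz
  have hinj := injective_mul_add (σ := σ) (z := z) hx
    (by rw [hz]; exact inv_ne_zero (mul_ne_zero hx hσx))
  have hV : (twistedZeros σ b).ncard = {c | σ c = c}.ncard ^ 2 := by
    rw [himg, hinj.ncard_image, Set.ncard_prod, sq]
  have hfix : ∀ c d, σ c = c → σ d = d → ((σ ^ r) (x * (c * z + d)) = x * (c * z + d) ↔
      c * partialTrace σ r (x * σ x)⁻¹ = 0) := by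
    intro c d hc hd
    simp only [map_mul, map_add, hxK, RingHom.pow_apply_of_fixed hc, RingHom.pow_apply_of_fixed hd,
      mul_right_inj' hx, add_left_inj, ← hτz, mul_add, CharTwo.add_eq_zero]
  refine ⟨hV, ?_⟩
  split_ifs with hT
  · rw [← hV]
    congr 1
    ext y
    simp only [Set.mem_ofPred_eq, and_iff_left_iff_imp]
    intro hy
    rw [himg] at hy
    obtain ⟨⟨c, d⟩, ⟨hc, hd⟩, rfl⟩ := hy
    exact (hfix c d hc hd).2 (by rw [hT, mul_zero])
  · rw [← Set.ncard_image_of_injective {c | σ c = c} (mul_right_injective₀ hx)]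
    congr 1
    ext y
    rw [himg]
    simp only [Set.mem_ofPred_eq, Set.mem_image, Set.mem_prod, Prod.exists]
    constructor
    · rintro ⟨⟨c, d, ⟨hc, hd⟩, rfl⟩, h⟩
      have := (hfix c d hc hd).1 h
      obtain rfl : c = 0 := (mul_eq_zero.1 this).resolve_right hT
      exact ⟨d, hd, by ring⟩
    · rintro ⟨d, hd, rfl⟩
      refine ⟨⟨0, d, ⟨map_zero σ, hd⟩, by ring⟩, ?_⟩
      rw [map_mul, hxK, RingHom.pow_apply_of_fixed hd]

theorem exists_fixed_twistedZero {σ : F →+* F} {r : ℕ}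
    (hinv : ∀ y, (σ ^ r) ((σ ^ r) y) = y) {b y : F} (hb : (σ ^ r) b = b)
    (hy0 : y ≠ 0) (hy : y ∈ twistedZeros σ b) :
    ∃ x, x ≠ 0 ∧ (σ ^ r) x = x ∧ x ∈ twistedZeros σ b := by
  by_cases h : (σ ^ r) y = y
  · exact ⟨y, hy0, h, hy⟩
  · refine ⟨(σ ^ r) y + y, fun h0 => h (CharTwo.add_eq_zero.1 h0), ?_, ?_⟩
    · rw [map_add, hinv, add_comm]
    · have hy : σ (σ y) + b * σ y + y = 0 := hy
      have hy' := congrArg (σ ^ r) hy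
      simp only [map_add, map_mul, map_zero, hb, RingHom.pow_apply_comm] at hy'
      change σ (σ _) + b * σ _ + _ = 0
      simp only [map_add]
      linear_combination hy + hy'

theorem ncard_twistedZeros_eq_one_or {σ : F →+* F} {r : ℕ}
    (hinv : ∀ y, (σ ^ r) ((σ ^ r) y) = y) (hne : ∃ y, (σ ^ r) y ≠ y)
    {b : F} (hb : (σ ^ r) b = b) :
    (twistedZeros σ b).ncard = 1 ∨ (twistedZeros σ b).ncard = {c | σ c = c}.ncard ^ 2 := by
  classical
  by_cases h : ∃ y, y ≠ 0 ∧ y ∈ twistedZeros σ b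
  · obtain ⟨y, hy0, hy⟩ := h
    obtain ⟨x, hx0, hxK, hx⟩ := exists_fixed_twistedZero hinv hb hy0 hy
    exact Or.inr (ncard_twistedZeros hinv hne hx0 hxK hx).1
  · left
    rw [Set.ncard_eq_one]
    refine ⟨0, Set.eq_singleton_iff_unique_mem.2 ⟨zero_mem_twistedZeros σ b, fun y hy => ?_⟩⟩
    by_contra h0
    exact h ⟨y, h0, hy⟩

/-- The form `y ↦ Tr (y σ y)` has exactly a `1 / q` share of zeros on the fixed field of `σ ^ r`,
where `q` is the size of the fixed field of `σ`. -/
theorem ncard_partialTrace_mul_eq_zero [Finite F] {σ : F →+* F} {r : ℕ} (hr : Odd r) :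
    {y | (σ ^ r) y = y ∧ partialTrace σ r (y * σ y) = 0}.ncard * {c | σ c = c}.ncard =
      {y | (σ ^ r) y = y}.ncard := by
  have two : (2 : F) = 0 := CharTwo.two_eq_zero
  have shift : ∀ y c, (σ ^ r) y = y → σ c = c →
      partialTrace σ r ((y + c) * σ (y + c)) = partialTrace σ r (y * σ y) + c ^ 2 := by
    intro y c hy hc
    have hcc : σ (c ^ 2) = c ^ 2 := by rw [map_pow, hc]
    have e : (y + c) * σ (y + c) = y * σ y + c * y + c * σ y + c ^ 2 := by
      rw [map_add, hc]; ring
    rw [e, partialTrace_add, partialTrace_add, partialTrace_add, partialTrace_mul_of_fixed hc,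
      partialTrace_mul_of_fixed hc, partialTrace_comm, map_partialTrace_of_fixed hy,
      partialTrace_fixed hr hcc]
    linear_combination (c * partialTrace σ r y) * two
  rw [← Set.ncard_prod]
  refine Set.ncard_congr (fun p _ => p.1 + p.2) ?_ ?_ ?_
  · rintro ⟨y, c⟩ ⟨⟨hy, -⟩, hc⟩
    simp only [Set.mem_ofPred_eq] at hc hy ⊢
    rw [map_add, hy, RingHom.pow_apply_of_fixed hc]
  · rintro ⟨y, c⟩ ⟨y', c'⟩ ⟨⟨hy, hyT⟩, hc⟩ ⟨⟨hy', hyT'⟩, hc'⟩ h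
    simp only [Set.mem_ofPred_eq] at hc hy hyT hc' hy' hyT' h
    have h1 := shift y c hy hc
    rw [h, shift y' c' hy' hc', hyT, hyT', zero_add, zero_add] at h1
    have h2 : c' = c := CharTwo.sq_injective h1
    subst h2
    exact Prod.ext (add_right_cancel h) rfl
  · intro y hy
    simp only [Set.mem_ofPred_eq] at hy
    have hyy : (σ ^ r) (y * σ y) = y * σ y := by rw [map_mul, RingHom.pow_apply_comm, hy]
    obtain ⟨c, hc⟩ : ∃ c : F, c ^ 2 = partialTrace σ r (y * σ y) :=
      (Finite.injective_iff_surjective.1 CharTwo.sq_injective) _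
    have hσc : σ c = c := by
      apply CharTwo.sq_injective
      change σ c ^ 2 = c ^ 2
      rw [← map_pow, hc, map_partialTrace_of_fixed hyy]
    refine ⟨(y + c, c), ⟨⟨?_, ?_⟩, hσc⟩, ?_⟩
    · rw [map_add, hy, RingHom.pow_apply_of_fixed hσc]
    · rw [shift y c hy hσc, hc]
      exact CharTwo.add_self_eq_zero _
    · linear_combination c * two

omit [CharP F 2] in
theorem RingHom.fixed_of_fixed_sq {σ : F →+* F} {r : ℕ} (hr : Odd r) {x : F}
    (hx : (σ ^ r) x = x) (h2 : σ (σ x) = x) : σ x = x := by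
  obtain ⟨j, rfl⟩ := hr
  rw [RingHom.pow_succ_apply, pow_mul] at hx
  rwa [RingHom.pow_apply_of_fixed (σ := σ ^ 2) (by rw [pow_two]; exact h2)] at hx

omit [CharP F 2] [Field F] in
theorem ncard_setOf_eq_card_filter [Fintype F] (p : F → Prop) [DecidablePred p] :
    {x | p x}.ncard = #{x | p x} := by
  rw [← Set.ncard_coe_finset]; simp

theorem ncard_setOf_ncard_twistedZeros [Finite F] {σ : F →+* F} {r : ℕ} (hr : Odd r)
    (hinv : ∀ y, (σ ^ r) ((σ ^ r) y) = y) (hne : ∃ y, (σ ^ r) y ≠ y) :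
    (({c | σ c = c}.ncard : ℤ) ^ 2 - 1) *
      {b | b ≠ 0 ∧ (σ ^ r) b = b ∧ (twistedZeros σ b).ncard = {c | σ c = c}.ncard ^ 2}.ncard =
      {c | σ c = c}.ncard * ({y | (σ ^ r) y = y}.ncard - {c | σ c = c}.ncard) := by
  classical
  have := Fintype.ofFinite F
  set q := {c | σ c = c}.ncard with hq
  have hq2 : 1 < q := by
    rw [hq, Set.one_lt_ncard]
    exact ⟨0, map_zero σ, 1, map_one σ, zero_ne_one⟩
  set k₀ : Finset F := univ.filter fun c => σ c = c with hk₀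
  set K : Finset F := univ.filter fun y => (σ ^ r) y = y with hK
  set D : Finset F := univ.filter fun x => (σ ^ r) x = x ∧ σ x ≠ x with hD
  set A : Finset F := univ.filter fun b =>
    b ≠ 0 ∧ (σ ^ r) b = b ∧ (twistedZeros σ b).ncard = q ^ 2 with hA
  set Z : Finset F := univ.filter fun y =>
    (σ ^ r) y = y ∧ partialTrace σ r (y * σ y) = 0 with hZ
  have hk₀c : k₀.card = q := by
    rw [hq, ncard_setOf_eq_card_filter]
  have hKc : {y | (σ ^ r) y = y}.ncard = K.card := by
    rw [hK, ncard_setOf_eq_card_filter]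
  have hAc : {b | b ≠ 0 ∧ (σ ^ r) b = b ∧ (twistedZeros σ b).ncard = q ^ 2}.ncard = A.card := by
    rw [hA, ncard_setOf_eq_card_filter]
  have hZc : Z.card * q = K.card := by
    rw [← hKc, hq, ← ncard_partialTrace_mul_eq_zero hr,
      ncard_setOf_eq_card_filter fun y => (σ ^ r) y = y ∧ partialTrace σ r (y * σ y) = 0]
  have hDc : (D.card : ℤ) = K.card - q := by
    have hDK : D = K \ k₀ := by ext x; simp [-RingHom.coe_pow, hD, hK, hk₀]
    have hsub : k₀ ⊆ K := by
      intro x hx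
      simp only [hk₀, hK, mem_filter, mem_univ, true_and] at hx ⊢
      exact RingHom.pow_apply_of_fixed hx r
    rw [hDK, card_sdiff_of_subset hsub, Nat.cast_sub (card_le_card hsub), hk₀c]
  have h0Z : (0 : F) ∈ Z := by simp [-RingHom.coe_pow, hZ, partialTrace]
  have hD₀ : #{x ∈ D | partialTrace σ r (x * σ x)⁻¹ = 0} = #(Z.erase 0) := by
    refine card_nbij' (·⁻¹) (·⁻¹) ?_ ?_ (fun _ _ => inv_inv _) (fun _ _ => inv_inv _)
    · intro x hx
      simp only [hD, hZ, coe_filter, mem_filter, mem_univ, true_and, coe_erase, Set.mem_sdiff,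
        Set.mem_ofPred_eq, Set.mem_singleton_iff, map_inv₀, inv_eq_zero, ← mul_inv] at hx ⊢
      refine ⟨⟨by rw [hx.1.1], hx.2⟩, ?_⟩
      rintro rfl
      exact hx.1.2 (map_zero σ)
    · intro y hy
      simp only [hD, hZ, coe_filter, mem_filter, mem_univ, true_and, coe_erase, Set.mem_sdiff,
        Set.mem_ofPred_eq, Set.mem_singleton_iff, map_inv₀, inv_inv, mul_inv, inv_inj] at hy ⊢
      obtain ⟨⟨hyK, hyT⟩, hy0⟩ := hy
      refine ⟨⟨hyK, fun h => hy0 ?_⟩, hyT⟩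
      replace h := inv_injective h
      rw [partialTrace_fixed hr (by rw [map_mul, h, h]), h] at hyT
      exact mul_self_eq_zero.1 hyT
  have hD₀c : (#{x ∈ D | partialTrace σ r (x * σ x)⁻¹ = 0} : ℤ) = Z.card - 1 := by
    rw [hD₀, card_erase_of_mem h0Z, Nat.cast_sub (card_pos.2 ⟨0, h0Z⟩), Nat.cast_one]
  set w : F → ℤ := fun x => if partialTrace σ r (x * σ x)⁻¹ = 0 then 1 else (q : ℤ) + 1 with hw
  have hmem : ∀ b x, x ≠ 0 → ((σ (σ x) + x) / σ x = b ↔ x ∈ twistedZeros σ b) := by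
    intro b x hx
    have hσx : σ x ≠ 0 := (map_ne_zero σ).2 hx
    rw [div_eq_iff hσx]
    change _ ↔ σ (σ x) + b * σ x + x = 0
    rw [add_right_comm, CharTwo.add_eq_zero]
  have hD0 : ∀ x ∈ D, x ≠ 0 := by
    rintro x hx rfl
    simp [-RingHom.coe_pow, hD] at hx
  have hmaps : ∀ x ∈ D, (σ (σ x) + x) / σ x ∈ A := by
    intro x hx
    have hx0 := hD0 x hx
    simp only [hD, mem_filter, mem_univ, true_and] at hx
    simp only [hA, mem_filter, mem_univ, true_and]
    refine ⟨div_ne_zero (fun h => hx.2 ?_) ((map_ne_zero σ).2 hx0), ?_, ?_⟩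
    · exact RingHom.fixed_of_fixed_sq hr hx.1 (CharTwo.add_eq_zero.1 h)
    · simp only [map_div₀, map_add, RingHom.pow_apply_comm, hx.1]
    · exact (ncard_twistedZeros hinv hne hx0 hx.1 ((hmem _ x hx0).1 rfl)).1
  have hfib : ∀ b ∈ A, ∑ x ∈ D with (σ (σ x) + x) / σ x = b, w x = (q : ℤ) ^ 2 - 1 := by
    intro b hb
    simp only [hA, mem_filter, mem_univ, true_and] at hb
    obtain ⟨hb0, hbK, hbV⟩ := hb
    obtain ⟨y, hyV, hy0⟩ := Set.exists_ne_of_one_lt_ncard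
      (by rw [hbV]; exact Nat.one_lt_pow two_ne_zero hq2) (0 : F)
    obtain ⟨x₀, hx₀0, hx₀K, hx₀V⟩ := exists_fixed_twistedZero hinv hbK hy0 hyV
    set P : Finset F := univ.filter fun y => y ∈ twistedZeros σ b ∧ (σ ^ r) y = y with hP
    have hPc : {y | y ∈ twistedZeros σ b ∧ (σ ^ r) y = y}.ncard = P.card := by
      rw [hP, ncard_setOf_eq_card_filter]
    have h0P : (0 : F) ∈ P := by simp [-RingHom.coe_pow, hP, zero_mem_twistedZeros]
    have hfe : {x ∈ D | (σ (σ x) + x) / σ x = b} = P.erase 0 := by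
      ext x
      simp only [mem_filter, mem_erase]
      constructor
      · rintro ⟨hx, hxb⟩
        have hx0 := hD0 x hx
        refine ⟨hx0, ?_⟩
        simp only [hP, hD, mem_filter, mem_univ, true_and] at hx ⊢
        exact ⟨(hmem b x hx0).1 hxb, hx.1⟩
      · rintro ⟨hx0, hx⟩
        simp only [hP, hD, mem_filter, mem_univ, true_and] at hx ⊢
        have hxb := (hmem b x hx0).2 hx.1
        refine ⟨⟨hx.2, fun h => hb0 ?_⟩, hxb⟩
        rw [← hxb, h, h, CharTwo.add_self_eq_zero, zero_div]
    have hconst : ∀ x ∈ P.erase 0, w x * (P.card - 1) = (q : ℤ) ^ 2 - 1 := by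
      intro x hx
      simp only [hP, mem_erase, mem_filter, mem_univ, true_and] at hx
      have hN := (ncard_twistedZeros hinv hne hx.1 hx.2.2 hx.2.1).2
      rw [hPc, ← hq] at hN
      rw [hN]
      simp only [hw]
      split_ifs
      · push_cast; ring
      · ring
    have hc : ((P.erase 0).card : ℤ) = P.card - 1 := by
      rw [card_erase_of_mem h0P, Nat.cast_sub (card_pos.2 ⟨0, h0P⟩), Nat.cast_one]
    have hx₀P : x₀ ∈ P.erase 0 := by simp [-RingHom.coe_pow, hP, hx₀0, hx₀K, hx₀V]
    have hpos : ((P.card : ℤ) - 1) ≠ 0 := by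
      rw [← hc]
      exact_mod_cast (card_pos.2 ⟨x₀, hx₀P⟩).ne'
    rw [hfe]
    apply mul_right_cancel₀ hpos
    rw [sum_mul, sum_congr rfl hconst, sum_const, nsmul_eq_mul, hc, mul_comm]
  have hsum := sum_fiberwise_of_maps_to hmaps w
  rw [sum_congr rfl hfib, sum_const, nsmul_eq_mul] at hsum
  have hw' : ∑ x ∈ D, w x =
      ((q : ℤ) + 1) * D.card - q * #{x ∈ D | partialTrace σ r (x * σ x)⁻¹ = 0} := by
    have : ∀ x ∈ D, w x =
        ((q : ℤ) + 1) - q * (if partialTrace σ r (x * σ x)⁻¹ = 0 then 1 else 0) := by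
      intro x _
      simp only [hw]
      split_ifs <;> ring
    rw [sum_congr rfl this, sum_sub_distrib, sum_const, ← mul_sum, sum_boole, nsmul_eq_mul]
    ring
  have hZc' : (Z.card : ℤ) * q = K.card := by exact_mod_cast hZc
  rw [hAc, hKc]
  rw [hw', hDc, hD₀c] at hsum
  linear_combination hsum - hZc'

end PartialTrace

theorem ncard_pow_two_pow_eq_self {F : Type*} [Field F] [Fintype F] {m : ℕ}
    (hF : Fintype.card F = 2 ^ m) (j : ℕ) :
    {x : F | x ^ 2 ^ j = x}.ncard = 2 ^ Nat.gcd m j := by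
  have e : {x : F | x ^ 2 ^ j = x} =
      insert 0 ((fun u : Fˣ => (u : F)) '' ((powMonoidHom (2 ^ j - 1) : Fˣ →* Fˣ).ker : Set Fˣ)) := by
    ext x
    have hj : 2 ^ j = (2 ^ j - 1) + 1 := (Nat.sub_add_cancel Nat.one_le_two_pow).symm
    by_cases hx : x = 0
    · simp [hx]
    · simp only [Set.mem_ofPred_eq, Set.mem_insert_iff, hx, false_or, Set.mem_image,
        SetLike.mem_coe, MonoidHom.mem_ker, powMonoidHom_apply]
      rw [hj, pow_succ, mul_eq_right₀ hx]
      constructor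
      · intro h
        exact ⟨Units.mk0 x hx, by ext; simpa using h, rfl⟩
      · rintro ⟨u, hu, rfl⟩
        simpa using congrArg Units.val hu
  rw [e, Set.ncard_insert_of_notMem (by simp), Set.ncard_image_of_injective _ Units.val_injective]
  have h := IsCyclic.card_powMonoidHom_ker (G := Fˣ) (2 ^ j - 1)
  rw [Nat.card_units, Nat.card_eq_fintype_card (α := F), hF, Nat.pow_sub_one_gcd_pow_sub_one] at h
  rw [← Nat.card_coe_set_eq]
  change Nat.card (powMonoidHom (2 ^ j - 1) : Fˣ →* Fˣ).ker + 1 = _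
  rw [h, Nat.sub_add_cancel Nat.one_le_two_pow]

theorem iterateFrobenius_pow_apply {F : Type*} [Field F] [CharP F 2] (t i : ℕ) (x : F) :
    (iterateFrobenius F 2 t ^ i) x = x ^ 2 ^ (t * i) := by
  induction i with
  | zero => simp
  | succ i ih =>
    rw [RingHom.pow_succ_apply, ih, iterateFrobenius_def, ← pow_mul, ← pow_add, mul_add, mul_one]

/-- With the standing notation (`n = kr`, `m = 2n`, `l = ks`,
`t = n + l`, …), for every `a ∈ F_{2^n}^*` the number of roots in `F` of
`f_a(x) = x^{2^{2t}} + a^{2^l}·x^{2^t} + x` is `1` or `2^{2k}`, and the counts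
`R_m = #{a ∈ F_{2^n}^* : N(f_a,F) = 1}` and `R_{m−2k} = #{a ∈ F_{2^n}^* : N(f_a,F) = 2^{2k}}`
satisfy `(2^{2k}−1)·R_m = 2^{n+2k} − 2^{n+k} − 2^n + 1` and
`(2^{2k}−1)·R_{m−2k} = 2^{n+k} − 2^{2k}`. -/
theorem rank_enumeration
    (k r s n m l t : ℕ) (hk : 1 ≤ k) (hr : 3 ≤ r) (hro : Odd r)
    (hn : n = k * r) (hm : m = 2 * n) (hl : l = k * s)
    (hse : Even s) (hs0 : 0 < s) (hsr : s < r) (hrs : Nat.gcd r s = 1)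
    (ht : t = n + l)
    (F : Type) [Field F] [Fintype F] (hF : Fintype.card F = 2 ^ m) :
    (∀ a : F, a ≠ 0 → a ^ 2 ^ n = a →
        Nat.card {x : F | x ^ 2 ^ (2 * t) + a ^ 2 ^ l * x ^ 2 ^ t + x = 0} = 1 ∨
        Nat.card {x : F | x ^ 2 ^ (2 * t) + a ^ 2 ^ l * x ^ 2 ^ t + x = 0}
          = 2 ^ (2 * k)) ∧
    ((2 : ℤ) ^ (2 * k) - 1) *
        (Nat.card {a : F | a ≠ 0 ∧ a ^ 2 ^ n = a ∧
          Nat.card {x : F | x ^ 2 ^ (2 * t) + a ^ 2 ^ l * x ^ 2 ^ t + x = 0} = 1} : ℤ)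
      = 2 ^ (n + 2 * k) - 2 ^ (n + k) - 2 ^ n + 1 ∧
    ((2 : ℤ) ^ (2 * k) - 1) *
        (Nat.card {a : F | a ≠ 0 ∧ a ^ 2 ^ n = a ∧
          Nat.card {x : F | x ^ 2 ^ (2 * t) + a ^ 2 ^ l * x ^ 2 ^ t + x = 0}
            = 2 ^ (2 * k)} : ℤ)
      = 2 ^ (n + k) - 2 ^ (2 * k) := by
  have hF0 : Nat.card F = 2 ^ m := by rw [Nat.card_eq_fintype_card, hF]
  have hchar : CharP F 2 := by
    obtain ⟨p, hp⟩ := CharP.exists F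
    obtain ⟨e, hpp, he⟩ := FiniteField.card F p
    rw [hF] at he
    have hdvd : p ∣ 2 ^ m := he ▸ dvd_pow_self p e.ne_zero
    have := (Nat.prime_dvd_prime_iff_eq hpp Nat.prime_two).1 (hpp.dvd_of_dvd_pow hdvd)
    rwa [this] at hp
  set σ : F →+* F := iterateFrobenius F 2 t with hσ
  have hσa : ∀ x, σ x = x ^ 2 ^ t := fun x => iterateFrobenius_def 2 t x
  have hτ : ∀ y, (σ ^ r) y = y ^ 2 ^ n := by
    intro y
    obtain ⟨j, hj⟩ : Odd (r + s) := hro.add_even hse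
    have e : t * r = m * j + n := by
      have : t * r = n * (r + s) := by rw [ht, hl, hn]; ring
      rw [this, hj, hm]; ring
    rw [hσ, iterateFrobenius_pow_apply, e, pow_add, pow_mul, pow_mul, ← hF,
      FiniteField.pow_card_pow]
  have hinv : ∀ y, (σ ^ r) ((σ ^ r) y) = y := by
    intro y
    rw [hτ, hτ, ← pow_mul, ← pow_add, ← two_mul, ← hm, ← hF, FiniteField.pow_card]
  have hgcd : Nat.gcd m t = k := by
    have h1 : m = k * (2 * r) := by rw [hm, hn]; ring
    have h2 : t = k * (r + s) := by rw [ht, hn, hl]; ring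
    have h3 : Nat.Coprime (2 * r) (r + s) := by
      refine Nat.Coprime.mul_left ?_ ?_
      · exact Nat.coprime_two_left.2 (hro.add_even hse)
      · exact (Nat.coprime_self_add_right).2 hrs
    rw [h1, h2, Nat.gcd_mul_left, h3, mul_one]
  have hq : {c | σ c = c}.ncard = 2 ^ k := by
    simp only [hσa]
    rw [ncard_pow_two_pow_eq_self hF, hgcd]
  have hK : {y | (σ ^ r) y = y}.ncard = 2 ^ n := by
    simp only [hτ]
    rw [ncard_pow_two_pow_eq_self hF, hm, Nat.gcd_mul_left_left]
  have hn0 : 0 < n := by rw [hn]; positivity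
  have hne : ∃ y, (σ ^ r) y ≠ y := by
    by_contra! h
    have : {y | (σ ^ r) y = y} = Set.univ := Set.eq_univ_of_forall h
    rw [this, Set.ncard_univ, hF0] at hK
    have := Nat.pow_right_injective le_rfl hK
    omega
  have hV : ∀ a : F, a ^ 2 ^ n = a →
      Nat.card {x : F | x ^ 2 ^ (2 * t) + a ^ 2 ^ l * x ^ 2 ^ t + x = 0} =
        (twistedZeros σ (σ a)).ncard := by
    intro a ha
    rw [Nat.card_coe_set_eq]
    congr 1
    ext x
    simp only [twistedZeros, Set.mem_ofPred_eq, hσa]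
    rw [← pow_mul, ← pow_add, ← two_mul, ht, pow_add 2 n l, pow_mul a, ha]
  have hq2 : ∀ b : F, b ^ 2 ^ n = b →
      (twistedZeros σ b).ncard = 1 ∨ (twistedZeros σ b).ncard = 2 ^ (2 * k) := by
    intro b hb
    have h := ncard_twistedZeros_eq_one_or (σ := σ) (r := r) hinv hne (b := b) (by rw [hτ, hb])
    rwa [hq, ← pow_mul, mul_comm k] at h
  have hσK : ∀ a : F, a ^ 2 ^ n = a → σ a ^ 2 ^ n = σ a := by
    intro a ha
    rw [← map_pow, ha]
  have hcount : ∀ c : ℕ, Nat.card {a : F | a ≠ 0 ∧ a ^ 2 ^ n = a ∧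
      Nat.card {x : F | x ^ 2 ^ (2 * t) + a ^ 2 ^ l * x ^ 2 ^ t + x = 0} = c} =
      {b : F | b ≠ 0 ∧ b ^ 2 ^ n = b ∧ (twistedZeros σ b).ncard = c}.ncard := by
    intro c
    rw [Nat.card_coe_set_eq]
    refine Set.ncard_congr (fun a _ => σ a) ?_ ?_ ?_
    · rintro a ⟨ha0, ha, hac⟩
      exact ⟨(map_ne_zero σ).2 ha0, hσK a ha, by rw [← hV a ha, hac]⟩
    · intro a b _ _ h
      exact σ.injective h
    · rintro b ⟨hb0, hb, hbc⟩
      obtain ⟨a, rfl⟩ := (Finite.injective_iff_surjective.1 σ.injective) b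
      have ha : a ^ 2 ^ n = a := σ.injective (by rw [map_pow, hb])
      exact ⟨a, ⟨(map_ne_zero σ).1 hb0, ha, by rw [hV a ha, hbc]⟩, rfl⟩
  have hlarge := ncard_setOf_ncard_twistedZeros (σ := σ) hro hinv hne
  rw [hK, hq, ← pow_mul, mul_comm k] at hlarge
  simp only [hτ] at hlarge
  have hk2 : 1 < 2 ^ (2 * k) := Nat.one_lt_two_pow (by omega)
  have htotal : {b : F | b ≠ 0 ∧ b ^ 2 ^ n = b ∧ (twistedZeros σ b).ncard = 1}.ncard +
      {b : F | b ≠ 0 ∧ b ^ 2 ^ n = b ∧ (twistedZeros σ b).ncard = 2 ^ (2 * k)}.ncard + 1 =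
      2 ^ n := by
    rw [← Set.ncard_union_eq, ← Set.ncard_insert_of_notMem (a := (0 : F)) (by simp)]
    · refine Eq.trans ?_ hK
      congr 1
      ext b
      simp only [Set.mem_insert_iff, Set.mem_union, Set.mem_ofPred_eq, hτ]
      constructor
      · rintro (rfl | h | h)
        · exact zero_pow (by positivity)
        · exact h.2.1
        · exact h.2.1
      · intro hb
        by_cases hb0 : b = 0
        · exact Or.inl hb0
        · exact Or.inr ((hq2 b hb).imp (fun h => ⟨hb0, hb, h⟩) fun h => ⟨hb0, hb, h⟩)
    · rw [Set.disjoint_left]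
      rintro b ⟨-, -, h1⟩ ⟨-, -, h2⟩
      omega
  refine ⟨fun a _ ha => ?_, ?_, ?_⟩
  · rw [hV a ha]
    exact hq2 _ (hσK a ha)
  · rw [hcount]
    have htotal' := congrArg (Nat.cast : ℕ → ℤ) htotal
    push_cast at htotal' hlarge
    linear_combination ((2 : ℤ) ^ (2 * k) - 1) * htotal' - hlarge
  · rw [hcount]
    push_cast at hlarge
    linear_combination hlarge
end

section
/- Let m = 2n and let d be a positive integer with gcd(d, 2^n − 1) = 1. Then: (1) Σ_{τ=0}^{2^n−2} C_d(τ) = 1, and (2) Σ_{τ=0}^{2^n−2} (C_d(τ) + 1)² = 2^m·(2^n − 1). -/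
open Finset

-- For `v` in the prime subfield `{0,1}` of `F`, `sgnF v` is the integer `(−1)^v`:
-- `1` if `v = 0` and `−1` if `v = 1`.
open Classical in
noncomputable def sgnF {F : Type*} [Zero F] (v : F) : ℤ :=
  if v = 0 then 1 else -1

-- `trF j x = Σ_{i=0}^{j−1} x^(2^i)`.
def trF {F : Type*} [Field F] (j : ℕ) (x : F) : F :=
  ∑ i ∈ Finset.range j, x ^ 2 ^ i

-- The cross correlation `C_d(τ) = Σ_{t=0}^{2^m−2} (−1)^{s_t + u_{d(t+τ)}}` between the
-- `m`-sequence `s_t = tr_m(α^t)` of period `2^m−1` and the `d`-decimation of the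
-- `m`-sequence `u_t = tr_n(β^t)` of period `2^n−1`, where `β = α^(2^n+1)`.
noncomputable def crossCorr {F : Type*} [Field F] (m n d : ℕ) (α : F) (τ : ℕ) : ℤ :=
  ∑ t ∈ Finset.range (2 ^ m - 1),
    sgnF (trF m (α ^ t) + trF n ((α ^ (2 ^ n + 1)) ^ (d * (t + τ))))

section BinarySums

variable {F : Type*} [Field F]

theorem trF_zero {j : ℕ} : trF j (0 : F) = 0 := by
  simp [trF]

theorem trF_add [CharP F 2] (j : ℕ) (x y : F) : trF j (x + y) = trF j x + trF j y := by
  simp [trF, add_pow_char_pow, Finset.sum_add_distrib]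

theorem trF_sq [CharP F 2] {j : ℕ} {x : F} (hx : x ^ 2 ^ j = x) : trF j x ^ 2 = trF j x := by
  have h := (Finset.sum_range_succ' (fun i => x ^ 2 ^ i) j).symm.trans
    (Finset.sum_range_succ (fun i => x ^ 2 ^ i) j)
  rw [hx, pow_zero, pow_one, add_left_inj] at h
  simp only [trF, sum_pow_char, ← pow_mul, ← pow_succ]
  exact h

theorem sgnF_add [CharP F 2] {a b : F} (ha : a ^ 2 = a) (hb : b ^ 2 = b) :
    sgnF (a + b) = sgnF a * sgnF b := by
  have h01 : ∀ c : F, c ^ 2 = c → c = 0 ∨ c = 1 := fun c hc => by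
    have h : c * (c - 1) = 0 := by linear_combination hc
    exact (mul_eq_zero.mp h).imp_right sub_eq_zero.mp
  rcases h01 a ha with rfl | rfl <;> rcases h01 b hb with rfl | rfl <;>
    simp [sgnF, CharTwo.add_self_eq_zero]

theorem sgnF_trF_add [CharP F 2] {j : ℕ} {x y : F} (hx : x ^ 2 ^ j = x) (hy : y ^ 2 ^ j = y) :
    sgnF (trF j (x + y)) = sgnF (trF j x) * sgnF (trF j y) := by
  rw [trF_add, sgnF_add (trF_sq hx) (trF_sq hy)]

theorem pow_two_pow_eq_self_iff {j : ℕ} {x : F} (hx : x ≠ 0) :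
    x ^ 2 ^ j = x ↔ x ^ (2 ^ j - 1) = 1 := by
  obtain ⟨k, hk⟩ := Nat.exists_eq_add_of_lt (Nat.two_pow_pos j)
  rw [hk, pow_succ]
  simp [hx]

theorem sum_range_pow_eq_sum_filter [Fintype F] [DecidableEq F] {k : ℕ} {ζ : F} (hk : 0 < k)
    (hζ : IsPrimitiveRoot ζ k) (g : F → ℤ) :
    ∑ i ∈ range k, g (ζ ^ i) = ∑ x with x ^ k = 1, g x := by
  have := NeZero.of_pos hk
  refine Finset.sum_bij (fun i _ => ζ ^ i) ?_ ?_ ?_ fun _ _ => rfl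
  · intro i _
    rw [mem_filter, pow_right_comm, hζ.pow_eq_one, one_pow]
    exact ⟨mem_univ _, rfl⟩
  · intro i hi l hl h
    exact hζ.pow_inj (mem_range.mp hi) (mem_range.mp hl) h
  · intro x hx
    obtain ⟨i, hi, h⟩ := hζ.eq_pow_of_pow_eq_one (mem_filter.mp hx).2
    exact ⟨i, mem_range.mpr hi, h⟩

theorem sum_frobeniusFixed [Fintype F] [DecidableEq F] {j : ℕ} (hj : 0 < j) {ζ : F}
    (hζ : IsPrimitiveRoot ζ (2 ^ j - 1)) (g : F → ℤ) :
    ∑ x with x ^ 2 ^ j = x, g x = g 0 + ∑ i ∈ range (2 ^ j - 1), g (ζ ^ i) := by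
  have hk : 0 < 2 ^ j - 1 := Nat.sub_pos_of_lt (Nat.one_lt_two_pow hj.ne')
  have hS : ({x | x ^ 2 ^ j = x} : Finset F) =
      insert 0 (univ.filter fun x : F => x ^ (2 ^ j - 1) = 1) := by
    ext x
    rcases eq_or_ne x 0 with rfl | hx
    · simp
    · simp [hx, pow_two_pow_eq_self_iff hx]
  rw [hS, sum_insert (by simp [hk.ne']), sum_range_pow_eq_sum_filter hk hζ]

theorem exists_trF_ne_zero [Fintype F] [DecidableEq F] {j : ℕ} (hj : 0 < j) {ζ : F}
    (hζ : IsPrimitiveRoot ζ (2 ^ j - 1)) : ∃ x : F, x ^ 2 ^ j = x ∧ trF j x ≠ 0 := by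
  by_contra! h
  let P : Polynomial F := ∑ i ∈ range j, Polynomial.X ^ 2 ^ i
  have hcard : (#{x : F | x ^ 2 ^ j = x} : ℤ) = 2 ^ j := by
    have := sum_frobeniusFixed hj hζ fun _ => 1
    have h1 : 1 ≤ 2 ^ j := Nat.one_le_two_pow
    simp only [sum_const, card_range, nsmul_eq_mul, mul_one] at this
    push_cast [h1] at this
    linarith
  have hdeg : P.natDegree ≤ 2 ^ (j - 1) := by
    refine Polynomial.natDegree_sum_le_of_forall_le _ _ fun i hi => ?_
    rw [Polynomial.natDegree_X_pow]
    exact Nat.pow_le_pow_right two_pos (Nat.le_sub_one_of_lt (mem_range.mp hi))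
  have hP : P = 0 := by
    refine Polynomial.eq_zero_of_natDegree_lt_card_of_eval_eq_zero' P
      {x : F | x ^ 2 ^ j = x} (fun x hx => ?_) ?_
    · simpa [P, trF, Polynomial.eval_finsetSum] using h x (mem_filter.mp hx).2
    · refine hdeg.trans_lt ?_
      rw [show #{x : F | x ^ 2 ^ j = x} = 2 ^ j by exact_mod_cast hcard]
      exact Nat.pow_lt_pow_right one_lt_two (by omega)
  have hc : P.coeff 1 = 1 := by
    rw [Polynomial.finsetSum_coeff, Finset.sum_eq_single 0]
    · simp
    · intro i _ hi
      rw [Polynomial.coeff_X_pow, if_neg (Nat.one_lt_two_pow hi).ne]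
    · simp [hj.ne']
  simp [hP] at hc

theorem sum_range_sgnF_trF [CharP F 2] [Fintype F] [DecidableEq F] {j : ℕ} (hj : 0 < j) {ζ : F}
    (hζ : IsPrimitiveRoot ζ (2 ^ j - 1)) {a : F} (ha : a ^ 2 ^ j = a) (ha0 : a ≠ 0) :
    ∑ i ∈ range (2 ^ j - 1), sgnF (trF j (a * ζ ^ i)) = -1 := by
  obtain ⟨x₀, hx₀, htr⟩ := exists_trF_ne_zero hj hζ
  have hsum : ∑ x : F with x ^ 2 ^ j = x, sgnF (trF j (a * x)) = 0 := by
    have hfix : (a⁻¹ * x₀) ^ 2 ^ j = a⁻¹ * x₀ := by rw [mul_pow, inv_pow, ha, hx₀]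
    have hneg : ∑ x : F with x ^ 2 ^ j = x, sgnF (trF j (a * x)) =
        ∑ x : F with x ^ 2 ^ j = x, -sgnF (trF j (a * x)) := by
      refine Finset.sum_nbij' (fun x => a⁻¹ * x₀ + x) (fun x => a⁻¹ * x₀ + x) ?_ ?_ ?_ ?_ ?_
      · intro x hx
        simp only [mem_filter, mem_univ, true_and] at hx ⊢
        rw [add_pow_char_pow, hfix, hx]
      · intro x hx
        simp only [mem_filter, mem_univ, true_and] at hx ⊢
        rw [add_pow_char_pow, hfix, hx]
      · intro x _
        rw [← add_assoc, CharTwo.add_self_eq_zero, zero_add]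
      · intro x _
        rw [← add_assoc, CharTwo.add_self_eq_zero, zero_add]
      · intro x hx
        have hx' : (a * x) ^ 2 ^ j = a * x := by rw [mul_pow, ha, (mem_filter.mp hx).2]
        rw [mul_add, mul_inv_cancel_left₀ ha0, sgnF_trF_add hx₀ hx',
          show sgnF (trF j x₀) = -1 from if_neg htr, neg_one_mul, neg_neg]
    rw [Finset.sum_neg_distrib] at hneg
    linarith
  rw [sum_frobeniusFixed hj hζ] at hsum
  simp only [mul_zero, trF_zero, sgnF, if_true] at hsum ⊢
  linarith

theorem sum_range_sgnF_trF_ite [CharP F 2] [Fintype F] [DecidableEq F] {j : ℕ} (hj : 0 < j)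
    {ζ : F} (hζ : IsPrimitiveRoot ζ (2 ^ j - 1)) {a : F} (ha : a ^ 2 ^ j = a) :
    ∑ i ∈ range (2 ^ j - 1), sgnF (trF j (a * ζ ^ i)) = (if a = 0 then 2 ^ j else 0) - 1 := by
  split_ifs with h
  · simp [h, trF_zero, sgnF]
  · rw [sum_range_sgnF_trF hj hζ ha h, zero_sub]

theorem isPrimitiveRoot_of_forall_exists_pow [Fintype F] {α : F} (hα0 : α ≠ 0)
    (hα : ∀ x : F, x ≠ 0 → ∃ j : ℕ, α ^ j = x) : IsPrimitiveRoot α (Fintype.card F - 1) := by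
  classical
  have h : orderOf (Units.mk0 α hα0) = Nat.card Fˣ :=
    orderOf_eq_card_of_forall_mem_zpowers fun x => by
      obtain ⟨j, hj⟩ := hα x x.ne_zero
      exact ⟨j, Units.ext (by simpa using hj)⟩
  rw [Nat.card_eq_fintype_card, Fintype.card_units] at h
  rw [← h, IsPrimitiveRoot.iff_orderOf, ← orderOf_units, Units.val_mk0]

end BinarySums

section NormFibres

variable {F : Type*} [Field F] {n : ℕ} {α : F}

theorem isPrimitiveRoot_pow_norm (hn : 0 < n) (hα : IsPrimitiveRoot α (2 ^ (2 * n) - 1)) :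
    IsPrimitiveRoot (α ^ (2 ^ n + 1)) (2 ^ n - 1) ∧
      IsPrimitiveRoot (α ^ (2 ^ n - 1)) (2 ^ n + 1) := by
  have hpos : 0 < 2 ^ (2 * n) - 1 := Nat.sub_pos_of_lt (Nat.one_lt_two_pow (by omega))
  have hmul : 2 ^ (2 * n) - 1 = (2 ^ n + 1) * (2 ^ n - 1) := by
    rw [mul_comm 2 n, pow_mul, ← Nat.sq_sub_sq, one_pow]
  exact ⟨hα.pow hpos hmul, hα.pow hpos (hmul.trans (mul_comm _ _))⟩

variable [Fintype F]

theorem frobenius_fixed_of_card (hF : Fintype.card F = 2 ^ (2 * n)) (x : F) :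
    x ^ 2 ^ (2 * n) = x := by
  rw [← hF, FiniteField.pow_card]

theorem norm_pow_two_pow (hF : Fintype.card F = 2 ^ (2 * n)) (x : F) :
    (x ^ (2 ^ n + 1)) ^ 2 ^ n = x ^ (2 ^ n + 1) := by
  have h := frobenius_fixed_of_card hF x
  rw [← pow_mul, show (2 ^ n + 1) * 2 ^ n = 2 ^ (2 * n) + 2 ^ n by ring, pow_add, h, mul_comm,
    ← pow_succ]

theorem crossCorr_eq [CharP F 2] (hF : Fintype.card F = 2 ^ (2 * n)) (d τ : ℕ) :
    crossCorr (2 * n) n d α τ = ∑ t ∈ range (2 ^ (2 * n) - 1), sgnF (trF (2 * n) (α ^ t)) *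
      sgnF (trF n (((α ^ t) ^ (2 ^ n + 1)) ^ d * ((α ^ (2 ^ n + 1)) ^ d) ^ τ)) := by
  refine Finset.sum_congr rfl fun t _ => ?_
  have hpow : (α ^ (2 ^ n + 1)) ^ (d * (t + τ)) =
      ((α ^ t) ^ (2 ^ n + 1)) ^ d * ((α ^ (2 ^ n + 1)) ^ d) ^ τ := by ring
  rw [sgnF_add (trF_sq (frobenius_fixed_of_card hF _)) (trF_sq ?_), hpow]
  rw [← pow_mul _ (d * (t + τ)), mul_comm (d * (t + τ)), pow_mul, norm_pow_two_pow hF]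

variable [DecidableEq F]

theorem sum_univ_eq_add_sum_range (hn : 0 < n) (hF : Fintype.card F = 2 ^ (2 * n))
    (hα : IsPrimitiveRoot α (2 ^ (2 * n) - 1)) (g : F → ℤ) :
    ∑ x, g x = g 0 + ∑ t ∈ range (2 ^ (2 * n) - 1), g (α ^ t) := by
  rw [← sum_frobeniusFixed (by omega) hα]
  simp [frobenius_fixed_of_card hF]

variable [CharP F 2]

theorem sum_sgnF_trF_mul (hn : 0 < n) (hF : Fintype.card F = 2 ^ (2 * n))
    (hα : IsPrimitiveRoot α (2 ^ (2 * n) - 1)) (a : F) :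
    ∑ x, sgnF (trF (2 * n) (a * x)) = if a = 0 then 2 ^ (2 * n) else 0 := by
  rw [sum_univ_eq_add_sum_range hn hF hα,
    sum_range_sgnF_trF_ite (by omega) hα (frobenius_fixed_of_card hF a)]
  simp [trF_zero, sgnF]

theorem sum_sum_norm_eq (hn : 0 < n) (hF : Fintype.card F = 2 ^ (2 * n))
    (hα : IsPrimitiveRoot α (2 ^ (2 * n) - 1)) :
    ∑ x : F, ∑ z : F, (if x ^ (2 ^ n + 1) = z ^ (2 ^ n + 1)
      then sgnF (trF (2 * n) (x + z)) else 0) = 2 ^ (2 * n) - 2 ^ n := by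
  have hfib : ∀ x : F, x ≠ 0 → ∑ z : F, (if x ^ (2 ^ n + 1) = z ^ (2 ^ n + 1)
      then sgnF (trF (2 * n) (x + z)) else 0) =
      ∑ u : F with u ^ (2 ^ n + 1) = 1, sgnF (trF (2 * n) ((1 + u) * x)) := by
    intro x hx
    rw [Finset.sum_filter]
    refine (Fintype.sum_equiv (Equiv.mulRight₀ x hx) _ _ fun u => ?_).symm
    have hiff : u ^ (2 ^ n + 1) = 1 ↔ x ^ (2 ^ n + 1) = (u * x) ^ (2 ^ n + 1) := by
      rw [mul_pow, eq_comm, eq_comm (a := x ^ _), mul_eq_right₀ (pow_ne_zero _ hx), eq_comm]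
    simp only [Equiv.mulRight₀_apply, hiff, add_mul, one_mul]
  have hcard : (#{u : F | u ^ (2 ^ n + 1) = 1} : ℤ) = 2 ^ n + 1 := by
    have := sum_range_pow_eq_sum_filter (by positivity) (isPrimitiveRoot_pow_norm hn hα).2
      fun _ => 1
    simpa using this.symm
  have hone : ∀ u : F, 1 + u = 0 ↔ u = 1 := fun u => by
    rw [CharTwo.add_eq_zero, eq_comm]
  have hsplit : ∀ g : F → ℤ, ∑ x, g x = g 0 + ∑ x with x ≠ 0, g x := fun g => by
    rw [← Finset.add_sum_erase _ _ (mem_univ (0 : F)), Finset.filter_ne']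
  have hzero : ∑ z : F, (if (0 : F) ^ (2 ^ n + 1) = z ^ (2 ^ n + 1)
      then sgnF (trF (2 * n) (0 + z)) else 0) = 1 := by
    rw [Finset.sum_eq_single 0]
    · simp [trF_zero, sgnF]
    · intro z _ hz
      rw [zero_pow (by positivity), if_neg (pow_ne_zero _ hz).symm]
    · simp
  have hinner : ∀ u : F, ∑ x : F with x ≠ 0, sgnF (trF (2 * n) ((1 + u) * x)) =
      (if u = 1 then 2 ^ (2 * n) else 0) - 1 := fun u => by
    have := sum_sgnF_trF_mul hn hF hα (1 + u)
    rw [hsplit] at this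
    simp only [mul_zero, trF_zero, sgnF, if_true, hone] at this ⊢
    linarith
  rw [hsplit, hzero, Finset.sum_congr rfl fun x hx => hfib x (mem_filter.mp hx).2,
    Finset.sum_comm, Finset.sum_congr rfl fun u _ => hinner u, Finset.sum_sub_distrib]
  simp only [sum_const, nsmul_eq_mul, mul_one, hcard]
  rw [Finset.sum_ite_eq' _ (1 : F)]
  simp
  ring

end NormFibres

/-- first and second moment identities. Let `m = 2n` and `d > 0` with
`gcd(d, 2^n − 1) = 1`.  Then `Σ_{τ=0}^{2^n−2} C_d(τ) = 1` and
`Σ_{τ=0}^{2^n−2} (C_d(τ)+1)² = 2^m·(2^n − 1)`. -/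
theorem crossCorr_moment_identities
    (n m d : ℕ) (hn : 0 < n) (hm : m = 2 * n) (hd : 0 < d)
    (hgcd : Nat.gcd d (2 ^ n - 1) = 1)
    (F : Type) [Field F] [Fintype F] (hF : Fintype.card F = 2 ^ m)
    (α : F) (hα0 : α ≠ 0) (hα : ∀ x : F, x ≠ 0 → ∃ j : ℕ, α ^ j = x) :
    (∑ τ ∈ Finset.range (2 ^ n - 1), crossCorr m n d α τ) = 1 ∧
    (∑ τ ∈ Finset.range (2 ^ n - 1), (crossCorr m n d α τ + 1) ^ 2)
      = 2 ^ m * (2 ^ n - 1) := by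
  subst hm
  classical
  have : CharP F 2 := charP_of_card_eq_prime_pow hF
  have hprim : IsPrimitiveRoot α (2 ^ (2 * n) - 1) :=
    hF ▸ isPrimitiveRoot_of_forall_exists_pow hα0 hα
  have hβ : IsPrimitiveRoot ((α ^ (2 ^ n + 1)) ^ d) (2 ^ n - 1) :=
    (isPrimitiveRoot_pow_norm hn hprim).1.pow_of_coprime d hgcd
  have hN : ∀ x : F, ((x ^ (2 ^ n + 1)) ^ d) ^ 2 ^ n = (x ^ (2 ^ n + 1)) ^ d := fun x => by
    rw [pow_right_comm, norm_pow_two_pow hF]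
  constructor
  · simp only [crossCorr_eq hF]
    rw [Finset.sum_comm]
    simp only [← Finset.mul_sum]
    rw [Finset.sum_congr rfl fun t _ => by
      rw [sum_range_sgnF_trF hn hβ (hN _) (pow_ne_zero _ (pow_ne_zero _ (pow_ne_zero _ hα0)))]]
    have h := sum_range_sgnF_trF (by omega) hprim (one_pow _) one_ne_zero
    simp only [one_mul] at h
    rw [← Finset.sum_mul, h]
    norm_num
  · have hC : ∀ τ, crossCorr (2 * n) n d α τ + 1 = ∑ x : F, sgnF (trF (2 * n) x) *
        sgnF (trF n ((x ^ (2 ^ n + 1)) ^ d * ((α ^ (2 ^ n + 1)) ^ d) ^ τ)) := fun τ => by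
      rw [sum_univ_eq_add_sum_range hn hF hprim, crossCorr_eq hF]
      simp [trF_zero, sgnF, hd.ne', add_comm]
    have hβfix : ∀ τ, (((α ^ (2 ^ n + 1)) ^ d) ^ τ) ^ 2 ^ n = ((α ^ (2 ^ n + 1)) ^ d) ^ τ :=
      fun τ => by rw [pow_right_comm, hN]
    have hinj : ∀ x z : F, (x ^ (2 ^ n + 1)) ^ d + (z ^ (2 ^ n + 1)) ^ d = 0 ↔
        x ^ (2 ^ n + 1) = z ^ (2 ^ n + 1) := fun x z => by
      rw [CharTwo.add_eq_zero]
      refine ⟨fun h => ?_, fun h => by rw [h]⟩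
      rcases eq_or_ne z 0 with rfl | hz
      · simpa [hd.ne'] using h
      rcases eq_or_ne x 0 with rfl | hx
      · simp [hd.ne', hz, eq_comm (a := (0 : F))] at h
      have h1 : ∀ y : F, y ≠ 0 → (y ^ (2 ^ n + 1)) ^ (2 ^ n - 1) = 1 := fun y hy =>
        (pow_two_pow_eq_self_iff (pow_ne_zero _ hy)).mp (norm_pow_two_pow hF y)
      have hq : (x ^ (2 ^ n + 1) / z ^ (2 ^ n + 1)) ^ Nat.gcd d (2 ^ n - 1) = 1 := by
        refine pow_gcd_eq_one.mpr ⟨?_, ?_⟩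
        · rw [div_pow, h, div_self (pow_ne_zero _ (pow_ne_zero _ hz))]
        · rw [div_pow, h1 x hx, h1 z hz, div_one]
      rw [hgcd, pow_one] at hq
      exact (div_eq_one_iff_eq (pow_ne_zero _ hz)).mp hq
    have hχ : ∑ x : F, sgnF (trF (2 * n) x) = 0 := by
      simpa using sum_sgnF_trF_mul hn hF hprim 1
    have hterm : ∀ x z : F, ∑ τ ∈ range (2 ^ n - 1),
        (sgnF (trF (2 * n) x) *
          sgnF (trF n ((x ^ (2 ^ n + 1)) ^ d * ((α ^ (2 ^ n + 1)) ^ d) ^ τ))) *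
        (sgnF (trF (2 * n) z) *
          sgnF (trF n ((z ^ (2 ^ n + 1)) ^ d * ((α ^ (2 ^ n + 1)) ^ d) ^ τ))) =
        2 ^ n * (if x ^ (2 ^ n + 1) = z ^ (2 ^ n + 1) then sgnF (trF (2 * n) (x + z)) else 0) -
          sgnF (trF (2 * n) x) * sgnF (trF (2 * n) z) := fun x z => by
      have hfix : ((x ^ (2 ^ n + 1)) ^ d + (z ^ (2 ^ n + 1)) ^ d) ^ 2 ^ n =
          (x ^ (2 ^ n + 1)) ^ d + (z ^ (2 ^ n + 1)) ^ d := by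
        rw [add_pow_char_pow, hN, hN]
      have h := sum_range_sgnF_trF_ite hn hβ hfix
      simp only [hinj] at h
      rw [sgnF_trF_add (frobenius_fixed_of_card hF x) (frobenius_fixed_of_card hF z)]
      trans sgnF (trF (2 * n) x) * sgnF (trF (2 * n) z) *
        ((if x ^ (2 ^ n + 1) = z ^ (2 ^ n + 1) then 2 ^ n else 0) - 1)
      · rw [← h, Finset.mul_sum]
        refine Finset.sum_congr rfl fun τ _ => ?_
        rw [add_mul, sgnF_trF_add (by rw [mul_pow, hN, hβfix]) (by rw [mul_pow, hN, hβfix])]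
        ring
      · split_ifs <;> ring
    simp only [hC, sq, Finset.sum_mul_sum]
    rw [Finset.sum_comm, Finset.sum_congr rfl fun x _ => Finset.sum_comm]
    simp only [hterm, Finset.sum_sub_distrib, ← Finset.mul_sum, ← Finset.sum_mul, hχ]
    rw [sum_sum_norm_eq hn hF hprim]
    ring
end
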